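/- If a convex polygon M is folded flat into another convex polygon M' (i.e., there is a piecewise-isometric map f : M → ℝ² with image M', where f is 1-Lipschitz), then the perimeter of M' does not exceed the perimeter of M. -/

import Mathlib

open MeasureTheory Metric Set

section PerimeterComparison

open scoped RealInnerProductSpace Pointwise

section Gaussian

variable {V : Type*} [NormedAddCommGroup V]

/-- The unnormalised standard Gaussian density on a normed space. -/
noncomputable def gaussWeight (x : V) : ℝ := Real.exp (-‖x‖ ^ 2 / 2)

lemma gaussWeight_pos (x : V) : 0 < gaussWeight x := Real.exp_pos _

lemma continuous_gaussWeight : Continuous (gaussWeight : V → ℝ) := by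
  unfold gaussWeight; fun_prop

variable [InnerProductSpace ℝ V]

lemma hasFDerivAt_gaussWeight (x : V) :
    HasFDerivAt gaussWeight (-(gaussWeight x • innerSL ℝ x)) x := by
  have h : HasFDerivAt (fun y : V => -‖y‖ ^ 2 / 2) (-(innerSL ℝ x)) x := by
    have := ((hasStrictFDerivAt_norm_sq x).hasFDerivAt.neg).const_smul (1 / 2 : ℝ)
    refine (this.congr_fderiv ?_).congr_of_eventuallyEq (.of_forall fun y => ?_)
    · ext v; simp
    · simp; ring
  exact h.exp.congr_fderiv (by ext v; simp [gaussWeight])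

variable [FiniteDimensional ℝ V] [MeasurableSpace V] [BorelSpace V]

lemma integrable_exp_neg_mul_sq_norm {b : ℝ} (hb : 0 < b) :
    Integrable (fun x : V => Real.exp (-b * ‖x‖ ^ 2)) := by
  have h := (GaussianFourier.integrable_cexp_neg_mul_sq_norm_add (V := V) (b := (b : ℂ))
    (by simpa using hb) 0 0).norm
  refine h.congr (.of_forall fun x => ?_)
  simp only [zero_mul, add_zero, Complex.norm_exp]
  congr 1
  norm_cast

lemma integrable_gaussWeight : Integrable (gaussWeight : V → ℝ) := by
  refine (integrable_exp_neg_mul_sq_norm (V := V) (b := 1 / 2) (by norm_num)).congr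
    (.of_forall fun x => ?_)
  simp only [gaussWeight]
  congr 1; ring

lemma integrable_norm_mul_gaussWeight : Integrable (fun x : V => ‖x‖ * gaussWeight x) := by
  refine ((integrable_exp_neg_mul_sq_norm (V := V) (b := 1 / 4) (by norm_num)).const_mul 2).mono'
    (continuous_norm.mul continuous_gaussWeight).aestronglyMeasurable (.of_forall fun x => ?_)
  rw [Real.norm_of_nonneg (mul_nonneg (norm_nonneg _) (gaussWeight_pos x).le)]
  have h1 : gaussWeight x = Real.exp (-(‖x‖ ^ 2 / 4)) * Real.exp (-(1 / 4) * ‖x‖ ^ 2) := by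
    rw [← Real.exp_add, gaussWeight]; congr 1; ring
  have h2 : ‖x‖ * Real.exp (-(‖x‖ ^ 2 / 4)) ≤ 2 := by
    rw [Real.exp_neg, ← div_eq_mul_inv, div_le_iff₀ (Real.exp_pos _)]
    nlinarith [Real.add_one_le_exp (‖x‖ ^ 2 / 4), sq_nonneg (‖x‖ - 1)]
  rw [h1, ← mul_assoc]
  exact mul_le_mul_of_nonneg_right h2 (Real.exp_pos _).le

lemma integrable_mul_gaussWeight_of_le {G : V → ℝ} {A B : ℝ} (hG : Continuous G)
    (h : ∀ x, |G x| ≤ A + B * ‖x‖) : Integrable (fun x => G x * gaussWeight x) := by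
  refine ((integrable_gaussWeight (V := V).const_mul A).add
    (integrable_norm_mul_gaussWeight.const_mul B)).mono'
    (hG.mul continuous_gaussWeight).aestronglyMeasurable (.of_forall fun x => ?_)
  rw [norm_mul, Real.norm_eq_abs, Real.norm_of_nonneg (gaussWeight_pos x).le]
  have := mul_le_mul_of_nonneg_right (h x) (gaussWeight_pos x).le
  simpa [add_mul, mul_assoc] using this

/-- Gaussian integration by parts. -/
lemma integral_mul_inner_mul_gaussWeight {G : V → ℝ} {G' : V → V →L[ℝ] ℝ} {A B : ℝ} (v : V)
    (hG : ∀ x, HasFDerivAt G (G' x) x) (hG' : Continuous fun x => G' x v)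
    (hA : ∀ x, |G x| ≤ A) (hB : ∀ x, |G' x v| ≤ B) :
    ∫ x, G x * ⟪x, v⟫ * gaussWeight x = ∫ x, G' x v * gaussWeight x := by
  have hGc : Continuous G := continuous_iff_continuousAt.2 fun x => (hG x).continuousAt
  have hf' : ∀ x, fderiv ℝ G x = G' x := fun x => (hG x).fderiv
  have hg' : ∀ x : V, fderiv ℝ gaussWeight x = -(gaussWeight x • innerSL ℝ x) :=
    fun x => (hasFDerivAt_gaussWeight x).fderiv
  have key := integral_mul_fderiv_eq_neg_fderiv_mul_of_integrable (μ := (volume : Measure V))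
    (f := G) (g := gaussWeight) (v := v) ?_ ?_ ?_
    (fun x _ => (hG x).differentiableAt) (fun x _ => (hasFDerivAt_gaussWeight x).differentiableAt)
  · simp only [hf', hg'] at key
    rw [← neg_inj, ← key, ← integral_neg]
    refine integral_congr_ae (.of_forall fun x => ?_)
    simp
    ring
  · simp only [hf']
    exact integrable_mul_gaussWeight_of_le (A := B) (B := 0) hG' (by simpa using hB)
  · simp only [hg']
    have := (integrable_mul_gaussWeight_of_le (G := fun x => G x * ⟪x, v⟫) (A := 0) (B := A * ‖v‖)
      (by fun_prop) (fun x => ?_)).neg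
    · refine this.congr (.of_forall fun x => ?_)
      simp
      ring
    · rw [abs_mul, zero_add, mul_assoc, mul_comm ‖v‖]
      exact mul_le_mul (hA x) (abs_real_inner_le_norm x v) (abs_nonneg _)
        ((abs_nonneg _).trans (hA x))
  · exact integrable_mul_gaussWeight_of_le (A := A) (B := 0) hGc (by simpa using hA)

end Gaussian

section Softmax

variable {V ι : Type*} [NormedAddCommGroup V] [InnerProductSpace ℝ V] [Fintype ι]

/-- The log-sum-exp function of the linear forms `⟪·, c i⟫`. -/
noncomputable def logSumExp (c : ι → V) (x : V) : ℝ := Real.log (∑ i, Real.exp ⟪x, c i⟫)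

/-- The softmax weights of the linear forms `⟪·, c i⟫`. -/
noncomputable def softmax (c : ι → V) (i : ι) (x : V) : ℝ :=
  Real.exp ⟪x, c i⟫ / ∑ j, Real.exp ⟪x, c j⟫

variable [Nonempty ι]

lemma sum_exp_inner_pos (c : ι → V) (x : V) : 0 < ∑ i, Real.exp ⟪x, c i⟫ :=
  Finset.sum_pos (fun _ _ => Real.exp_pos _) Finset.univ_nonempty

lemma softmax_nonneg (c : ι → V) (i : ι) (x : V) : 0 ≤ softmax c i x :=
  div_nonneg (Real.exp_pos _).le (sum_exp_inner_pos c x).le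

lemma sum_softmax (c : ι → V) (x : V) : ∑ i, softmax c i x = 1 := by
  simp only [softmax, ← Finset.sum_div]
  exact div_self (sum_exp_inner_pos c x).ne'

lemma softmax_le_one (c : ι → V) (i : ι) (x : V) : softmax c i x ≤ 1 := by
  rw [← sum_softmax c x]
  exact Finset.single_le_sum (fun j _ => softmax_nonneg c j x) (Finset.mem_univ i)

lemma continuous_softmax (c : ι → V) (i : ι) : Continuous (softmax c i) :=
  Continuous.div (by fun_prop) (by fun_prop) fun x => (sum_exp_inner_pos c x).ne'

lemma continuous_logSumExp (c : ι → V) : Continuous (logSumExp c) :=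
  Continuous.log (by fun_prop) fun x => (sum_exp_inner_pos c x).ne'

lemma inner_le_logSumExp (c : ι → V) (i : ι) (x : V) : ⟪x, c i⟫ ≤ logSumExp c x := by
  rw [logSumExp, Real.le_log_iff_exp_le (sum_exp_inner_pos c x)]
  exact Finset.single_le_sum (f := fun j => Real.exp ⟪x, c j⟫)
    (fun j _ => (Real.exp_pos _).le) (Finset.mem_univ i)

lemma logSumExp_le {c : ι → V} {x : V} {m : ℝ} (h : ∀ i, ⟪x, c i⟫ ≤ m) :
    logSumExp c x ≤ m + Real.log (Fintype.card ι) := by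
  rw [logSumExp, Real.log_le_iff_le_exp (sum_exp_inner_pos c x), Real.exp_add,
    Real.exp_log (by exact_mod_cast Fintype.card_pos)]
  calc _ ≤ ∑ _i : ι, Real.exp m := Finset.sum_le_sum fun i _ => Real.exp_le_exp.2 (h i)
    _ = _ := by simp [mul_comm]

lemma abs_logSumExp_le (c : ι → V) (x : V) :
    |logSumExp c x| ≤ Real.log (Fintype.card ι) + (∑ i, ‖c i‖) * ‖x‖ := by
  have hc : ∀ i, |⟪x, c i⟫| ≤ (∑ i, ‖c i‖) * ‖x‖ := fun i => by
    refine (abs_real_inner_le_norm x (c i)).trans ?_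
    rw [mul_comm]
    exact mul_le_mul_of_nonneg_right (Finset.single_le_sum (f := fun j => ‖c j‖)
      (fun j _ => norm_nonneg _) (Finset.mem_univ i)) (norm_nonneg x)
  have hlog : 0 ≤ Real.log (Fintype.card ι) :=
    Real.log_nonneg (by exact_mod_cast Nat.one_le_iff_ne_zero.2 Fintype.card_ne_zero)
  rw [abs_le]
  constructor
  · obtain ⟨i⟩ := ‹Nonempty ι›
    have h1 := inner_le_logSumExp c i x
    have h2 := (abs_le.1 (hc i)).1
    linarith
  · linarith [logSumExp_le (c := c) (x := x) fun i => (abs_le.1 (hc i)).2]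

lemma hasFDerivAt_softmax (c : ι → V) (i : ι) (x : V) :
    HasFDerivAt (softmax c i)
      (softmax c i x • (innerSL ℝ (c i) - ∑ j, softmax c j x • innerSL ℝ (c j))) x := by
  have he : ∀ j, HasFDerivAt (fun y : V => Real.exp ⟪y, c j⟫)
      (Real.exp ⟪x, c j⟫ • innerSL ℝ (c j)) x := fun j => by
    have h := ((innerSL ℝ (c j)).hasFDerivAt (x := x)).exp
    simpa [real_inner_comm] using h
  have hs := HasFDerivAt.fun_sum fun j (_ : j ∈ Finset.univ) => he j
  have hne := (sum_exp_inner_pos c x).ne'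
  have hfun : softmax c i = fun y => Real.exp (⟪y, c i⟫ - Real.log (∑ j, Real.exp ⟪y, c j⟫)) := by
    funext y
    rw [Real.exp_sub, Real.exp_log (sum_exp_inner_pos c y), softmax]
  have hi : HasFDerivAt (fun y : V => ⟪y, c i⟫) (innerSL ℝ (c i)) x := by
    simpa [real_inner_comm] using (innerSL ℝ (c i)).hasFDerivAt (x := x)
  rw [hfun]
  refine (hi.sub (hs.log hne)).exp.congr_fderiv ?_
  rw [Finset.smul_sum]
  congr 2
  refine Finset.sum_congr rfl fun j _ => ?_
  rw [smul_smul, softmax, div_eq_inv_mul]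

lemma hasDerivAt_logSumExp {c : ℝ → ι → V} {c' : ι → V} {t : ℝ}
    (hc : ∀ i, HasDerivAt (fun s => c s i) (c' i) t) (x : V) :
    HasDerivAt (fun s => logSumExp (c s) x) (∑ i, softmax (c t) i x * ⟪x, c' i⟫) t := by
  have he : ∀ i, HasDerivAt (fun s => Real.exp ⟪x, c s i⟫)
      (Real.exp ⟪x, c t i⟫ * ⟪x, c' i⟫) t := fun i => by
    have := ((hasDerivAt_const t x).inner ℝ (hc i)).exp
    simpa using this
  have hs := HasDerivAt.fun_sum fun i (_ : i ∈ Finset.univ) => he i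
  convert! hs.log (sum_exp_inner_pos (c t) x).ne' using 1
  rw [Finset.sum_div]
  exact Finset.sum_congr rfl fun i _ => by rw [softmax]; ring

lemma sum_softmax_mul_covariance (c c' : ι → V) (x : V) :
    ∑ i, softmax c i x * (⟪c i, c' i⟫ - ∑ j, softmax c j x * ⟪c j, c' i⟫) =
      (1 / 2) * ∑ i, ∑ j, softmax c i x * softmax c j x * ⟪c i - c j, c' i - c' j⟫ := by
  set p := fun i => softmax c i x with hp
  have h1 : ∑ i, p i = 1 := sum_softmax c x
  have e1 : ∑ i, ∑ j, p i * p j * ⟪c i - c j, c' i - c' j⟫ =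
      ∑ i, ∑ j, (p i * ⟪c i, c' i⟫ * p j) + ∑ i, ∑ j, (p i * (p j * ⟪c j, c' j⟫))
      - ∑ i, ∑ j, p i * (p j * ⟪c j, c' i⟫) - ∑ i, ∑ j, p i * (p j * ⟪c i, c' j⟫) := by
    simp only [← Finset.sum_add_distrib, ← Finset.sum_sub_distrib]
    refine Finset.sum_congr rfl fun i _ => Finset.sum_congr rfl fun j _ => ?_
    simp only [inner_sub_left, inner_sub_right]
    ring
  have e2 : ∑ i, ∑ j, p i * (p j * ⟪c i, c' j⟫) = ∑ i, ∑ j, p i * (p j * ⟪c j, c' i⟫) := by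
    rw [Finset.sum_comm]
    exact Finset.sum_congr rfl fun i _ => Finset.sum_congr rfl fun j _ => by ring
  change ∑ i, p i * (⟪c i, c' i⟫ - ∑ j, p j * ⟪c j, c' i⟫) =
    (1 / 2) * ∑ i, ∑ j, p i * p j * ⟪c i - c j, c' i - c' j⟫
  rw [e1, e2]
  simp only [← Finset.mul_sum, ← Finset.sum_mul, h1, mul_sub, Finset.sum_sub_distrib]
  ring

variable [FiniteDimensional ℝ V] [MeasurableSpace V] [BorelSpace V]

lemma integral_sum_softmax_mul_inner (c c' : ι → V) :
    ∫ x, (∑ i, softmax c i x * ⟪x, c' i⟫) * gaussWeight x =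
      ∫ x, (1 / 2) * (∑ i, ∑ j, softmax c i x * softmax c j x * ⟪c i - c j, c' i - c' j⟫)
        * gaussWeight x := by
  have hcont := continuous_softmax c
  have habs : ∀ i x, |softmax c i x| ≤ 1 := fun i x => by
    rw [abs_of_nonneg (softmax_nonneg c i x)]; exact softmax_le_one c i x
  set D : ι → V → V →L[ℝ] ℝ := fun i x =>
    softmax c i x • (innerSL ℝ (c i) - ∑ j, softmax c j x • innerSL ℝ (c j)) with hD
  have hDv : ∀ i x, D i x (c' i) =
      softmax c i x * (⟪c i, c' i⟫ - ∑ j, softmax c j x * ⟪c j, c' i⟫) := fun i x => by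
    simp [hD]
  have hDc : ∀ i, Continuous fun x => D i x (c' i) := fun i => by
    simp only [hDv]; fun_prop
  have hDb : ∀ i x, |D i x (c' i)| ≤ |⟪c i, c' i⟫| + ∑ j, |⟪c j, c' i⟫| := fun i x => by
    rw [hDv, abs_mul]
    refine (mul_le_of_le_one_left (abs_nonneg _) (habs i x)).trans ((abs_sub _ _).trans ?_)
    gcongr
    refine (Finset.abs_sum_le_sum_abs _ _).trans (Finset.sum_le_sum fun j _ => ?_)
    rw [abs_mul]
    exact mul_le_of_le_one_left (abs_nonneg _) (habs j x)
  have hibp : ∀ i, ∫ x, softmax c i x * ⟪x, c' i⟫ * gaussWeight x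
      = ∫ x, D i x (c' i) * gaussWeight x := fun i =>
    integral_mul_inner_mul_gaussWeight (c' i) (hasFDerivAt_softmax c i) (hDc i) (habs i) (hDb i)
  simp only [← sum_softmax_mul_covariance, Finset.sum_mul]
  rw [integral_finsetSum, integral_finsetSum]
  · simp only [hibp, hDv]
  · intro i _
    have := integrable_mul_gaussWeight_of_le (B := 0) (hDc i) (by simpa using hDb i)
    simpa only [hDv] using this
  · intro i _
    refine integrable_mul_gaussWeight_of_le (A := 0) (B := ‖c' i‖)
      ((hcont i).mul (by fun_prop)) fun x => ?_
    rw [abs_mul, zero_add, mul_comm ‖c' i‖]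
    exact (mul_le_of_le_one_left (abs_nonneg _) (habs i x)).trans (abs_real_inner_le_norm _ _)

/-- Gaussian interpolation between orthogonal families with comparable increments. -/
lemma integral_logSumExp_le_of_orthogonal {a b : ι → V} (hab : ∀ i j, ⟪a i, b j⟫ = 0)
    (h : ∀ i j, ‖b i - b j‖ ≤ ‖a i - a j‖) :
    ∫ x, logSumExp b x * gaussWeight x ≤ ∫ x, logSumExp a x * gaussWeight x := by
  set c : ℝ → ι → V := fun t i => Real.cos t • a i + Real.sin t • b i with hc
  set c' : ℝ → ι → V := fun t i => -Real.sin t • a i + Real.cos t • b i with hc'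
  have hcd : ∀ t i, HasDerivAt (fun s => c s i) (c' t i) t := fun t i =>
    ((Real.hasDerivAt_cos t).smul_const (a i)).add ((Real.hasDerivAt_sin t).smul_const (b i))
  set φ : ℝ → ℝ := fun t => ∫ x, logSumExp (c t) x * gaussWeight x with hφ
  have hint : ∀ t, Integrable fun x => logSumExp (c t) x * gaussWeight x := fun t =>
    integrable_mul_gaussWeight_of_le (continuous_logSumExp _) (abs_logSumExp_le _)
  have hb' : ∀ t x, |∑ i, softmax (c t) i x * ⟪x, c' t i⟫| ≤
      0 + (∑ i, (‖a i‖ + ‖b i‖)) * ‖x‖ := fun t x => by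
    rw [zero_add, Finset.sum_mul]
    refine (Finset.abs_sum_le_sum_abs _ _).trans (Finset.sum_le_sum fun i _ => ?_)
    rw [abs_mul, abs_of_nonneg (softmax_nonneg _ i x), mul_comm _ ‖x‖]
    refine (mul_le_of_le_one_left (abs_nonneg _) (softmax_le_one _ i x)).trans
      ((abs_real_inner_le_norm _ _).trans ?_)
    gcongr
    refine (norm_add_le _ _).trans ?_
    rw [norm_smul, norm_smul, norm_neg, Real.norm_eq_abs, Real.norm_eq_abs]
    exact add_le_add (mul_le_of_le_one_left (norm_nonneg _) (Real.abs_sin_le_one t))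
      (mul_le_of_le_one_left (norm_nonneg _) (Real.abs_cos_le_one t))
  have hmeas : ∀ t, Continuous fun x => ∑ i, softmax (c t) i x * ⟪x, c' t i⟫ := fun t =>
    continuous_finsetSum _ fun i _ => (continuous_softmax _ i).mul (by fun_prop)
  have hφd : ∀ t, HasDerivAt φ
      (∫ x, (∑ i, softmax (c t) i x * ⟪x, c' t i⟫) * gaussWeight x) t := fun t => by
    refine (hasDerivAt_integral_of_dominated_loc_of_deriv_le
      (F' := fun s x => (∑ i, softmax (c s) i x * ⟪x, c' s i⟫) * gaussWeight x)
      (bound := fun x => (0 + (∑ i, (‖a i‖ + ‖b i‖)) * ‖x‖) * gaussWeight x) Filter.univ_mem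
      (.of_forall fun s => (hint s).aestronglyMeasurable) (hint t)
      ((hmeas t).mul continuous_gaussWeight).aestronglyMeasurable
      (.of_forall fun x s _ => ?_) ?_ (.of_forall fun x s _ => ?_)).2
    · rw [norm_mul, Real.norm_eq_abs, Real.norm_of_nonneg (gaussWeight_pos x).le]
      exact mul_le_mul_of_nonneg_right (hb' s x) (gaussWeight_pos x).le
    · simpa [mul_assoc] using integrable_norm_mul_gaussWeight.const_mul (∑ i, (‖a i‖ + ‖b i‖))
    · exact (hasDerivAt_logSumExp (hcd s) x).mul_const _
  have hφ' : AntitoneOn φ (Icc 0 (Real.pi / 2)) := by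
    refine antitoneOn_of_deriv_nonpos (convex_Icc _ _)
      (fun t _ => (hφd t).continuousAt.continuousWithinAt)
      (fun t _ => (hφd t).differentiableAt.differentiableWithinAt) fun t ht => ?_
    rw [interior_Icc] at ht
    rw [(hφd t).deriv, integral_sum_softmax_mul_inner]
    refine integral_nonpos fun x => mul_nonpos_of_nonpos_of_nonneg
      (mul_nonpos_of_nonneg_of_nonpos (by norm_num) ?_) (gaussWeight_pos x).le
    refine Finset.sum_nonpos fun i _ => Finset.sum_nonpos fun j _ =>
      mul_nonpos_of_nonneg_of_nonpos
        (mul_nonneg (softmax_nonneg _ _ _) (softmax_nonneg _ _ _)) ?_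
    have e : ⟪c t i - c t j, c' t i - c' t j⟫ =
        Real.sin t * Real.cos t * (‖b i - b j‖ ^ 2 - ‖a i - a j‖ ^ 2) := by
      have e1 : c t i - c t j = Real.cos t • (a i - a j) + Real.sin t • (b i - b j) := by
        simp only [hc]; module
      have e2 : c' t i - c' t j = -Real.sin t • (a i - a j) + Real.cos t • (b i - b j) := by
        simp only [hc']; module
      have e3 : ⟪a i - a j, b i - b j⟫ = 0 := by
        simp [inner_sub_left, inner_sub_right, hab]
      have e4 : ⟪b i - b j, a i - a j⟫ = 0 := by rw [real_inner_comm]; exact e3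
      rw [e1, e2]
      simp only [inner_add_left, inner_add_right, real_inner_smul_left, real_inner_smul_right,
        e3, e4, real_inner_self_eq_norm_sq]
      ring
    rw [e]
    have hs : 0 ≤ Real.sin t := Real.sin_nonneg_of_nonneg_of_le_pi ht.1.le
      (by linarith [ht.2, Real.pi_pos])
    have hcs : 0 ≤ Real.cos t := Real.cos_nonneg_of_mem_Icc
      ⟨by linarith [ht.1, Real.pi_pos], ht.2.le⟩
    refine mul_nonpos_of_nonneg_of_nonpos (mul_nonneg hs hcs) (sub_nonpos.2 ?_)
    exact pow_le_pow_left₀ (norm_nonneg _) (h i j) 2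
  have hpi := Real.pi_pos
  have := hφ' (left_mem_Icc.2 (by linarith)) (right_mem_Icc.2 (by linarith)) (by linarith)
  simpa [hφ, hc] using this

end Softmax

section SupportFunction

variable {V : Type*} [NormedAddCommGroup V] [InnerProductSpace ℝ V]

/-- The support function of a set `S`. -/
noncomputable def supportFun (S : Set V) (x : V) : ℝ := sSup ((fun p => ⟪x, p⟫) '' S)

variable {S : Set V}

lemma IsCompact.inner_le_supportFun (hS : IsCompact S) (x : V) {p : V} (hp : p ∈ S) :
    ⟪x, p⟫ ≤ supportFun S x :=
  le_csSup (hS.image (by fun_prop)).bddAbove (mem_image_of_mem _ hp)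

lemma supportFun_le (hne : S.Nonempty) {x : V} {m : ℝ} (h : ∀ p ∈ S, ⟪x, p⟫ ≤ m) :
    supportFun S x ≤ m :=
  csSup_le (hne.image _) (by rintro _ ⟨p, hp, rfl⟩; exact h p hp)

lemma IsCompact.exists_inner_eq_supportFun (hS : IsCompact S) (hne : S.Nonempty) (x : V) :
    ∃ p ∈ S, ⟪x, p⟫ = supportFun S x :=
  (hS.image (f := fun p => ⟪x, p⟫) (by fun_prop)).sSup_mem (hne.image _)

lemma IsCompact.supportFun_add_le (hS : IsCompact S) (hne : S.Nonempty) (x y : V) :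
    supportFun S (x + y) ≤ supportFun S x + supportFun S y :=
  supportFun_le hne fun p hp => by
    rw [inner_add_left]
    exact add_le_add (hS.inner_le_supportFun x hp) (hS.inner_le_supportFun y hp)

lemma supportFun_smul (S : Set V) {r : ℝ} (hr : 0 ≤ r) (x : V) :
    supportFun S (r • x) = r * supportFun S x := by
  have : (fun p => ⟪r • x, p⟫) '' S = r • ((fun p => ⟪x, p⟫) '' S) := by
    rw [← image_smul, image_image]
    simp [real_inner_smul_left]
  rw [supportFun, this, Real.sSup_smul_of_nonneg hr, smul_eq_mul, supportFun]

lemma IsCompact.exists_abs_supportFun_le (hS : IsCompact S) (hne : S.Nonempty) :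
    ∃ R : ℝ, ∀ x, |supportFun S x| ≤ R * ‖x‖ := by
  obtain ⟨R, hR⟩ := hS.isBounded.exists_norm_le
  refine ⟨R, fun x => ?_⟩
  obtain ⟨p, hp, hpx⟩ := hS.exists_inner_eq_supportFun hne x
  rw [← hpx, mul_comm]
  exact (abs_real_inner_le_norm x p).trans
    (mul_le_mul_of_nonneg_left (hR p hp) (norm_nonneg x))

lemma IsCompact.continuous_supportFun (hS : IsCompact S) (hne : S.Nonempty) :
    Continuous (supportFun S) := by
  obtain ⟨R, hR⟩ := hS.exists_abs_supportFun_le hne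
  have h : ∀ x y, supportFun S x ≤ supportFun S y + R * dist x y := fun x y => by
    have := hS.supportFun_add_le hne y (x - y)
    rw [add_sub_cancel] at this
    rw [dist_eq_norm]
    linarith [(abs_le.1 (hR (x - y))).2]
  exact (LipschitzWith.of_le_add_mul' R h).continuous

lemma supportFun_le_of_net {T : Set V} (hT : IsCompact T) (hne : S.Nonempty) {ε : ℝ}
    (h : ∀ p ∈ S, ∃ q ∈ T, dist p q ≤ ε) (x : V) :
    supportFun S x ≤ supportFun T x + ε * ‖x‖ :=
  supportFun_le hne fun p hp => by
    obtain ⟨q, hq, hpq⟩ := h p hp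
    have h1 : ⟪x, p⟫ = ⟪x, q⟫ + ⟪x, p - q⟫ := by rw [← inner_add_right, add_sub_cancel]
    have h2 : ⟪x, p - q⟫ ≤ ‖x‖ * ‖p - q‖ := real_inner_le_norm _ _
    have h3 : ‖x‖ * ‖p - q‖ ≤ ‖x‖ * ε :=
      mul_le_mul_of_nonneg_left (by rwa [← dist_eq_norm]) (norm_nonneg x)
    linarith [hT.inner_le_supportFun x hq]

variable [FiniteDimensional ℝ V] [MeasurableSpace V] [BorelSpace V]

lemma IsCompact.integrable_supportFun_mul_gaussWeight (hS : IsCompact S) (hne : S.Nonempty) :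
    Integrable fun x => supportFun S x * gaussWeight x := by
  obtain ⟨R, hR⟩ := hS.exists_abs_supportFun_le hne
  exact integrable_mul_gaussWeight_of_le (A := 0) (B := R) (hS.continuous_supportFun hne)
    (by simpa using hR)

lemma integral_supportFun_le_of_net {T : Set V} (hS : IsCompact S) (hT : IsCompact T)
    (hne : S.Nonempty) (hneT : T.Nonempty) {ε : ℝ} (h : ∀ p ∈ S, ∃ q ∈ T, dist p q ≤ ε) :
    ∫ x, supportFun S x * gaussWeight x ≤
      (∫ x, supportFun T x * gaussWeight x) + ε * ∫ x : V, ‖x‖ * gaussWeight x := by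
  rw [← integral_const_mul, ← integral_add (hT.integrable_supportFun_mul_gaussWeight hneT)
    (integrable_norm_mul_gaussWeight.const_mul ε)]
  refine integral_mono (hS.integrable_supportFun_mul_gaussWeight hne)
    ((hT.integrable_supportFun_mul_gaussWeight hneT).add
      (integrable_norm_mul_gaussWeight.const_mul ε)) fun x => ?_
  have := mul_le_mul_of_nonneg_right (supportFun_le_of_net hT hne h x) (gaussWeight_pos x).le
  simp only
  linarith

/-- The Sudakov–Fernique inequality for log-sum-exp. -/
lemma integral_logSumExp_le {ι : Type*} [Fintype ι] [Nonempty ι] {p q : ι → V}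
    (h : ∀ i j, ‖q i - q j‖ ≤ ‖p i - p j‖) :
    ∫ x, logSumExp q x * gaussWeight x ≤ ∫ x, logSumExp p x * gaussWeight x := by
  set a : ι → WithLp 2 (V × V) := fun i => WithLp.toLp 2 (p i, 0) with ha
  set b : ι → WithLp 2 (V × V) := fun i => WithLp.toLp 2 (0, q i) with hb
  have hW := integral_logSumExp_le_of_orthogonal (a := a) (b := b)
    (fun i j => by simp [ha, hb, WithLp.prod_inner_apply]) fun i j => by
      have ea : a i - a j = WithLp.toLp 2 (p i - p j, 0) := by simp [ha, ← WithLp.toLp_sub]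
      have eb : b i - b j = WithLp.toLp 2 (0, q i - q j) := by simp [hb, ← WithLp.toLp_sub]
      rw [ea, eb]
      simpa using h i j
  have hmp := WithLp.volume_preserving_toLp V V
  have hemb : MeasurableEmbedding (WithLp.toLp 2 : V × V → WithLp 2 (V × V)) :=
    (MeasurableEquiv.toLp 2 (V × V)).measurableEmbedding
  have hwt : ∀ x y : V, gaussWeight (WithLp.toLp 2 (x, y)) = gaussWeight x * gaussWeight y :=
    fun x y => by
      simp only [gaussWeight, ← Real.exp_add, WithLp.prod_norm_sq_eq_of_L2]
      congr 1
      change -(‖x‖ ^ 2 + ‖y‖ ^ 2) / 2 = _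
      ring
  rw [← hmp.integral_comp hemb, ← hmp.integral_comp hemb, Measure.volume_eq_prod] at hW
  have hla : ∀ x y : V, logSumExp a (WithLp.toLp 2 (x, y)) = logSumExp p x := fun x y => by
    simp [logSumExp, ha, WithLp.prod_inner_apply]
  have hlb : ∀ x y : V, logSumExp b (WithLp.toLp 2 (x, y)) = logSumExp q y := fun x y => by
    simp [logSumExp, hb, WithLp.prod_inner_apply]
  have e1 : ∀ z : V × V, logSumExp a (WithLp.toLp 2 z) * gaussWeight (WithLp.toLp 2 z) =
      (logSumExp p z.1 * gaussWeight z.1) * gaussWeight z.2 := fun ⟨x, y⟩ => by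
    rw [hla, hwt]; ring
  have e2 : ∀ z : V × V, logSumExp b (WithLp.toLp 2 z) * gaussWeight (WithLp.toLp 2 z) =
      gaussWeight z.1 * (logSumExp q z.2 * gaussWeight z.2) := fun ⟨x, y⟩ => by
    rw [hlb, hwt]; ring
  simp only [e1, e2] at hW
  rw [integral_prod_mul (fun x => gaussWeight x) (fun y => logSumExp q y * gaussWeight y),
    integral_prod_mul (fun x => logSumExp p x * gaussWeight x) (fun y => gaussWeight y),
    mul_comm] at hW
  refine le_of_mul_le_mul_right hW ?_
  rw [integral_pos_iff_support_of_nonneg (fun x => (gaussWeight_pos x).le) integrable_gaussWeight]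
  have : Function.support (gaussWeight : V → ℝ) = univ := by
    ext x; simp [(gaussWeight_pos x).ne']
  rw [this]
  exact Measure.measure_univ_pos.2 (NeZero.ne _)

/-- The Gaussian mean width does not increase under contractions. -/
lemma integral_supportFun_image_le {M : Set V} {f : V → V} (hM : IsCompact M) (hne : M.Nonempty)
    (hf : LipschitzOnWith 1 f M) :
    ∫ x, supportFun (f '' M) x * gaussWeight x ≤ ∫ x, supportFun M x * gaussWeight x := by
  have hK : IsCompact (f '' M) := hM.image_of_continuousOn hf.continuousOn
  set N := ∫ x : V, ‖x‖ * gaussWeight x with hN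
  set c := ∫ x : V, gaussWeight x with hc
  have hN0 : 0 ≤ N := integral_nonneg fun x => mul_nonneg (norm_nonneg x) (gaussWeight_pos x).le
  have hc0 : 0 ≤ c := integral_nonneg fun x => (gaussWeight_pos x).le
  have key : ∀ ε > 0, ∫ x, supportFun (f '' M) x * gaussWeight x ≤
      (∫ x, supportFun M x * gaussWeight x) + ε * (N + 1) := fun ε hε => by
    obtain ⟨t, htK, htf, hcov⟩ := hK.finite_cover_balls hε
    have htne : t.Nonempty := by
      obtain ⟨p, hp⟩ := hne.image f
      obtain ⟨q, hq, -⟩ := mem_iUnion₂.1 (hcov hp)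
      exact ⟨q, hq⟩
    have := htf.fintype
    have := htne.to_subtype
    have hpre : ∀ i : t, ∃ p ∈ M, f p = i := fun i => htK i.2
    choose p hpM hpf using hpre
    set L := Real.log (Fintype.card t) with hL
    have hL0 : 0 ≤ L :=
      Real.log_nonneg (by exact_mod_cast Nat.one_le_iff_ne_zero.2 Fintype.card_ne_zero)
    set r := L * c / ε + 1 with hr
    have hr0 : 0 < r := by positivity
    have hint : ∀ c : t → V, Integrable fun x => logSumExp c x * gaussWeight x := fun c =>
      integrable_mul_gaussWeight_of_le (continuous_logSumExp _) (abs_logSumExp_le _)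
    have h1 := integral_supportFun_le_of_net hK htf.isCompact (hne.image f) htne (ε := ε)
      fun p hp => by
        obtain ⟨q, hq, hpq⟩ := mem_iUnion₂.1 (hcov hp)
        exact ⟨q, hq, (mem_ball.1 hpq).le⟩
    have h2 : r * ∫ x, supportFun t x * gaussWeight x ≤
        ∫ x, logSumExp (fun i : t => r • (i : V)) x * gaussWeight x := by
      rw [← integral_const_mul]
      refine integral_mono ((htf.isCompact.integrable_supportFun_mul_gaussWeight htne).const_mul r)
        (hint _) fun x => ?_
      simp only [← mul_assoc]
      refine mul_le_mul_of_nonneg_right ?_ (gaussWeight_pos x).le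
      rw [← le_div_iff₀' hr0]
      refine supportFun_le htne fun q hq => ?_
      rw [le_div_iff₀' hr0, ← real_inner_smul_right]
      exact inner_le_logSumExp (fun i : t => r • (i : V)) ⟨q, hq⟩ x
    have h3 : ∫ x, logSumExp (fun i : t => r • (i : V)) x * gaussWeight x ≤
        ∫ x, logSumExp (fun i : t => r • p i) x * gaussWeight x := by
      refine integral_logSumExp_le fun i j => ?_
      simp only [← smul_sub, norm_smul]
      refine mul_le_mul_of_nonneg_left ?_ (norm_nonneg _)
      rw [← hpf i, ← hpf j, ← dist_eq_norm, ← dist_eq_norm]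
      simpa using hf.dist_le_mul _ (hpM i) _ (hpM j)
    have h4 : ∫ x, logSumExp (fun i : t => r • p i) x * gaussWeight x ≤
        r * (∫ x, supportFun M x * gaussWeight x) + L * c := by
      rw [hc, ← integral_const_mul, ← integral_const_mul, ← integral_add
        ((hM.integrable_supportFun_mul_gaussWeight hne).const_mul r)
        (integrable_gaussWeight.const_mul L)]
      refine integral_mono (hint _) (((hM.integrable_supportFun_mul_gaussWeight hne).const_mul r).add
        (integrable_gaussWeight.const_mul L)) fun x => ?_
      simp only [← mul_assoc, ← add_mul]
      refine mul_le_mul_of_nonneg_right (logSumExp_le fun i => ?_) (gaussWeight_pos x).le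
      rw [real_inner_smul_right]
      exact mul_le_mul_of_nonneg_left (hM.inner_le_supportFun x (hpM i)) hr0.le
    have h5 : L * c ≤ r * ε := by rw [hr, add_mul, div_mul_cancel₀ _ hε.ne']; linarith
    have h6 : ∫ x, supportFun t x * gaussWeight x ≤
        (∫ x, supportFun M x * gaussWeight x) + ε := by
      refine le_of_mul_le_mul_left ?_ hr0
      rw [mul_add]
      linarith
    linarith
  refine le_of_forall_pos_le_add fun δ hδ => ?_
  have := key (δ / (N + 1)) (by positivity)
  rwa [div_mul_cancel₀ _ (by positivity)] at this

end SupportFunction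

section Hausdorff

lemma hausdorffMeasure_le_of_expanding {X Y : Type*} [MetricSpace X] [MetricSpace Y]
    [MeasurableSpace X] [BorelSpace X] [MeasurableSpace Y] [BorelSpace Y] {S : Set X} {T : Set Y}
    {d : ℝ} (hd : 0 ≤ d) (z : X → Y) (hz : MapsTo z S T)
    (h : ∀ x ∈ S, ∀ y ∈ S, dist x y ≤ dist (z x) (z y)) : μH[d] S ≤ μH[d] T := by
  rcases S.eq_empty_or_nonempty with rfl | ⟨x₀, hx₀⟩
  · simp
  have : Nonempty X := ⟨x₀⟩
  have hinj : InjOn z S := fun x hx y hy hxy =>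
    dist_le_zero.1 ((h x hx y hy).trans (by simp [hxy]))
  have hleft := hinj.leftInvOn_invFunOn
  have hlip : LipschitzOnWith 1 (Function.invFunOn z S) (z '' S) := by
    refine LipschitzOnWith.of_dist_le_mul ?_
    rintro _ ⟨x, hx, rfl⟩ _ ⟨y, hy, rfl⟩
    rw [hleft hx, hleft hy]
    simpa using h x hx y hy
  calc μH[d] S = μH[d] (Function.invFunOn z S '' (z '' S)) := by rw [hleft.image_image]
    _ ≤ μH[d] (z '' S) := by simpa using hlip.hausdorffMeasure_image_le hd
    _ ≤ μH[d] T := measure_mono hz.image_subset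

end Hausdorff

section Supporting

variable {V : Type*} [NormedAddCommGroup V] [InnerProductSpace ℝ V] [FiniteDimensional ℝ V]

/-- A supporting hyperplane exists at every frontier point, also when the interior is empty. -/
lemma Convex.exists_supporting_direction {K : Set V} (hK : Convex ℝ K) {y : V} (hy : y ∈ K)
    (hyi : y ∉ interior K) : ∃ v : V, ‖v‖ = 1 ∧ ∀ x ∈ K, ⟪v, x⟫ ≤ ⟪v, y⟫ := by
  suffices H : ∃ v : V, v ≠ 0 ∧ ∀ x ∈ K, ⟪v, x⟫ ≤ ⟪v, y⟫ by
    obtain ⟨v, hv, h⟩ := H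
    refine ⟨‖v‖⁻¹ • v, by simp [norm_smul, hv], fun x hx => ?_⟩
    rw [real_inner_smul_left, real_inner_smul_left]
    exact mul_le_mul_of_nonneg_left (h x hx) (by positivity)
  by_cases hne : (interior K).Nonempty
  · obtain ⟨f, hf0, hf⟩ := geometric_hahn_banach_of_nonempty_interior_point hK hyi hne
    refine ⟨(InnerProductSpace.toDual ℝ V).symm f, by simpa using hf0, fun x hx => ?_⟩
    simpa using hf x hx
  · have hspan : affineSpan ℝ K ≠ ⊤ := fun h => hne (hK.interior_nonempty_iff_affineSpan_eq_top.2 h)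
    have hdir : (affineSpan ℝ K).direction ≠ ⊤ := fun h => hspan
      ((AffineSubspace.direction_eq_top_iff_of_nonempty ⟨y, subset_affineSpan ℝ K hy⟩).1 h)
    have horth : (affineSpan ℝ K).directionᗮ ≠ ⊥ := fun h =>
      hdir (Submodule.orthogonal_eq_bot_iff.1 h)
    obtain ⟨v, hv, hv0⟩ := Submodule.exists_mem_ne_zero_of_ne_bot horth
    refine ⟨v, hv0, fun x hx => ?_⟩
    have := Submodule.inner_left_of_mem_orthogonal
      (AffineSubspace.vsub_mem_direction (subset_affineSpan ℝ K hx) (subset_affineSpan ℝ K hy)) hv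
    rw [vsub_eq_sub, inner_sub_right] at this
    linarith

end Supporting

section Upper

open Complex in
lemma complex_eq_frame {e : ℂ} (he : ‖e‖ = 1) (x : ℂ) :
    x = ⟪e, x⟫ • e + ⟪I * e, x⟫ • (I * e) := by
  have h : e.re * e.re + e.im * e.im = 1 := by
    rw [← normSq_apply, normSq_eq_norm_sq, he]; norm_num
  apply Complex.ext
  · simp [Complex.inner]
    linear_combination (-x.re) * h
  · simp [Complex.inner]
    linear_combination (-x.im) * h

/-- The side with normal `e` of a circumscribed polygon. -/
lemma hausdorffMeasure_side_le {e ζ : ℂ} (he : ‖e‖ = 1) (hζ : ‖ζ‖ = 1) (hs : 0 < ζ.im)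
    (a b c : ℝ) :
    μH[1] {x : ℂ | ⟪e, x⟫ = a ∧ ⟪ζ * e, x⟫ ≤ b ∧ ⟪ζ⁻¹ * e, x⟫ ≤ c} ≤
      ENNReal.ofReal ((b + c - 2 * ζ.re * a) / ζ.im) := by
  set g : ℝ → ℂ := fun s => a • e + s • (Complex.I * e) with hg
  have hiso : Isometry g := Isometry.of_dist_eq fun s t => by
    rw [dist_eq_norm, dist_eq_norm, hg]
    simp only [add_sub_add_left_eq_sub, ← sub_smul, norm_smul, norm_mul, Complex.norm_I, he]
    simp
  have hinv := Complex.inv_eq_conj hζ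
  have hsub : {x : ℂ | ⟪e, x⟫ = a ∧ ⟪ζ * e, x⟫ ≤ b ∧ ⟪ζ⁻¹ * e, x⟫ ≤ c} ⊆
      g '' Icc (-((c - ζ.re * a) / ζ.im)) ((b - ζ.re * a) / ζ.im) := by
    rintro x ⟨h1, h2, h3⟩
    refine ⟨⟪Complex.I * e, x⟫, ⟨?_, ?_⟩, ?_⟩
    · rw [neg_le, le_div_iff₀ hs]
      have : ⟪ζ⁻¹ * e, x⟫ = ζ.re * ⟪e, x⟫ - ζ.im * ⟪Complex.I * e, x⟫ := by
        rw [hinv]; simp [Complex.inner]; ring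
      rw [this, h1] at h3
      linarith
    · rw [le_div_iff₀ hs]
      have : ⟪ζ * e, x⟫ = ζ.re * ⟪e, x⟫ + ζ.im * ⟪Complex.I * e, x⟫ := by
        simp [Complex.inner]; ring
      rw [this, h1] at h2
      linarith
    · rw [hg, ← h1]; exact (complex_eq_frame he x).symm
  refine (measure_mono hsub).trans ?_
  rw [hiso.hausdorffMeasure_image (Or.inl zero_le_one), hausdorffMeasure_real, Real.volume_Icc]
  refine ENNReal.ofReal_le_ofReal (le_of_eq ?_)
  field_simp
  ring

lemma two_re_mul_supportFun_le {K : Set ℂ} (hK : IsCompact K) (hne : K.Nonempty) {ζ : ℂ}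
    (hζ : ‖ζ‖ = 1) (hc : 0 ≤ ζ.re) (x : ℂ) :
    2 * ζ.re * supportFun K x ≤ supportFun K (ζ * x) + supportFun K (ζ⁻¹ * x) := by
  have hsum : (2 * ζ.re) • x = ζ * x + ζ⁻¹ * x := by
    rw [← add_mul, Complex.inv_eq_conj hζ, Complex.add_conj, Complex.real_smul]
  rw [← supportFun_smul K (by positivity), hsum]
  exact hK.supportFun_add_le hne _ _

/-- The boundary of a convex set is not longer than a circumscribed polygon. -/
lemma hausdorffMeasure_frontier_le_sum {K : Set ℂ} (hK : IsCompact K) (hconv : Convex ℝ K)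
    (hne : K.Nonempty) {ζ u : ℂ} (hζ : ‖ζ‖ = 1) (hs : 0 < ζ.im) (hc : 0 ≤ ζ.re) (hu : ‖u‖ = 1)
    {Z : Finset ℂ} (hZ : ∀ z ∈ Z, ‖z‖ = 1) (hZζ : ∀ z ∈ Z, ζ * z ∈ Z) (hZζ' : ∀ z ∈ Z, ζ⁻¹ * z ∈ Z)
    (hpos : ∀ v : ℂ, v ≠ 0 → ∃ z ∈ Z, 0 < ⟪z * u, v⟫) :
    μH[1] (frontier K) ≤ ENNReal.ofReal (∑ z ∈ Z, (supportFun K (ζ * (z * u)) +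
      supportFun K (ζ⁻¹ * (z * u)) - 2 * ζ.re * supportFun K (z * u)) / ζ.im) := by
  have hZne : Z.Nonempty := by
    obtain ⟨z, hz, -⟩ := hpos 1 one_ne_zero
    exact ⟨z, hz⟩
  set h := supportFun K
  set side : ℂ → Set ℂ := fun z => {x : ℂ | ⟪z * u, x⟫ = h (z * u) ∧
    ⟪ζ * (z * u), x⟫ ≤ h (ζ * (z * u)) ∧ ⟪ζ⁻¹ * (z * u), x⟫ ≤ h (ζ⁻¹ * (z * u))}
  have hray : ∀ y ∈ frontier K, ∃ v : ℂ, ∃ s : ℝ, 0 ≤ s ∧ (∀ x ∈ K, ⟪v, x⟫ ≤ ⟪v, y⟫) ∧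
      y + s • v ∈ ⋃ z ∈ Z, side z := fun y hy => by
    have hyK : y ∈ K := hK.isClosed.frontier_subset hy
    obtain ⟨v, hv1, hv⟩ := hconv.exists_supporting_direction hyK hy.2
    have hv0 : v ≠ 0 := by rintro rfl; simp at hv1
    set m : ℝ → ℝ := fun s => Z.sup' hZne fun z => ⟪z * u, y + s • v⟫ - h (z * u) with hm
    have hmc : Continuous m := Continuous.finset_sup'_apply hZne fun z _ => by fun_prop
    have hm0 : m 0 ≤ 0 := Finset.sup'_le _ _ fun z _ => by
      simpa using hK.inner_le_supportFun (z * u) hyK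
    obtain ⟨z₀, hz₀, hz₀v⟩ := hpos v hv0
    set s₁ := (h (z₀ * u) - ⟪z₀ * u, y⟫) / ⟪z₀ * u, v⟫ with hs₁
    have hs₁0 : 0 ≤ s₁ := div_nonneg (sub_nonneg.2 (hK.inner_le_supportFun _ hyK)) hz₀v.le
    have hm1 : 0 ≤ m s₁ := by
      refine le_trans (le_of_eq ?_) (Finset.le_sup' (fun z => ⟪z * u, y + s₁ • v⟫ - h (z * u)) hz₀)
      rw [inner_add_right, real_inner_smul_right, hs₁, div_mul_cancel₀ _ hz₀v.ne']
      ring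
    obtain ⟨s, hsI, hms⟩ := intermediate_value_Icc hs₁0 hmc.continuousOn ⟨hm0, hm1⟩
    have hle : ∀ z ∈ Z, ⟪z * u, y + s • v⟫ ≤ h (z * u) := fun z hz => by
      have := Finset.le_sup' (fun z => ⟪z * u, y + s • v⟫ - h (z * u)) hz
      change _ ≤ m s at this
      rw [hms] at this
      linarith
    obtain ⟨z, hz, hzs⟩ := Finset.exists_mem_eq_sup' hZne
      fun z => ⟪z * u, y + s • v⟫ - h (z * u)
    change m s = _ at hzs
    rw [hms] at hzs
    refine ⟨v, s, hsI.1, hv, mem_iUnion₂.2 ⟨z, hz, by linarith, ?_, ?_⟩⟩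
    · rw [← mul_assoc]; exact hle _ (hZζ z hz)
    · rw [← mul_assoc]; exact hle _ (hZζ' z hz)
  choose! v s hs0 hv hmem using hray
  have h1 : μH[1] (frontier K) ≤ μH[1] (⋃ z ∈ Z, side z) := by
    refine hausdorffMeasure_le_of_expanding zero_le_one (fun y => y + s y • v y) hmem
      fun x hx y hy => ?_
    have hxK := hK.isClosed.frontier_subset hx
    have hyK := hK.isClosed.frontier_subset hy
    have e : ⟪x - y, (x + s x • v x) - (y + s y • v y)⟫ =
        ‖x - y‖ ^ 2 + s x * (⟪v x, x⟫ - ⟪v x, y⟫) + s y * (⟪v y, y⟫ - ⟪v y, x⟫) := by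
      rw [← real_inner_self_eq_norm_sq]
      simp only [inner_sub_left, inner_sub_right, inner_add_right, real_inner_smul_right]
      rw [real_inner_comm (v x) x, real_inner_comm (v x) y, real_inner_comm (v y) x,
        real_inner_comm (v y) y]
      ring
    have h2 := real_inner_le_norm (x - y) ((x + s x • v x) - (y + s y • v y))
    have h3 := mul_nonneg (hs0 x hx) (sub_nonneg.2 (hv x hx y hyK))
    have h4 := mul_nonneg (hs0 y hy) (sub_nonneg.2 (hv y hy x hxK))
    rw [dist_eq_norm, dist_eq_norm]
    rcases (norm_nonneg (x - y)).eq_or_lt with h0 | h0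
    · rw [← h0]; exact norm_nonneg _
    · refine le_of_mul_le_mul_left ?_ h0
      nlinarith
  refine h1.trans ((measure_biUnion_finset_le _ _).trans ?_)
  rw [ENNReal.ofReal_sum_of_nonneg]
  · refine Finset.sum_le_sum fun z hz => hausdorffMeasure_side_le ?_ hζ hs _ _ _
    rw [norm_mul, hZ z hz, hu, one_mul]
  · intro z _
    refine div_nonneg (sub_nonneg.2 ?_) hs.le
    exact two_re_mul_supportFun_le hK hne hζ hc _

lemma integral_comp_mul_mul_gaussWeight (G : ℂ → ℝ) {z : ℂ} (hz : ‖z‖ = 1) :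
    ∫ x, G (z * x) * gaussWeight x = ∫ x, G x * gaussWeight x := by
  let e : ℂ ≃ₗᵢ[ℝ] ℂ := rotation ⟨z, mem_sphere_zero_iff_norm.2 hz⟩
  have he : ∀ x, e x = z * x := fun x => rfl
  rw [← e.measurePreserving.integral_comp e.toHomeomorph.measurableEmbedding
    fun x => G x * gaussWeight x]
  refine integral_congr_ae (.of_forall fun x => ?_)
  simp [he, gaussWeight, hz]

/-- Cauchy's formula, upper bound for the perimeter. -/
lemma hausdorffMeasure_frontier_le {K : Set ℂ} (hK : IsCompact K) (hconv : Convex ℝ K)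
    (hne : K.Nonempty) : μH[1] (frontier K) ≠ ⊤ ∧
    (μH[1] (frontier K)).toReal * ∫ x : ℂ, ‖x‖ * gaussWeight x ≤
      2 * Real.pi * ∫ x, supportFun K x * gaussWeight x := by
  set m := μH[1] (frontier K) with hm
  set J := ∫ x, supportFun K x * gaussWeight x
  have hpi := Real.pi_pos
  have key : ∀ k : ℕ, m ≠ ⊤ ∧ m.toReal * (∫ x : ℂ, ‖x‖ * gaussWeight x) *
      Real.cos (Real.pi / (4 * (k + 2))) ≤ 2 * Real.pi * J := fun k => by
    set n : ℕ := 4 * (k + 2) with hn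
    have hn0 : n ≠ 0 := by omega
    have hnr : (n : ℝ) = 4 * (k + 2) := by rw [hn]; push_cast; ring
    have hnpos : (0 : ℝ) < n := by positivity
    set α := Real.pi / n with hα
    have hα0 : 0 < α := by positivity
    have hα1 : α ≤ Real.pi / 8 := by
      rw [hα]
      refine div_le_div_of_nonneg_left hpi.le (by norm_num) ?_
      rw [hnr]
      linarith [(Nat.cast_nonneg k : (0 : ℝ) ≤ k)]
    set ζ := Complex.exp (2 * Real.pi * Complex.I / n) with hζdef
    have hprim : IsPrimitiveRoot ζ n := Complex.isPrimitiveRoot_exp n hn0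
    have hζe : ζ = Complex.exp ((2 * α : ℝ) * Complex.I) := by
      rw [hζdef, hα]; congr 1; push_cast; ring
    have hζn : ‖ζ‖ = 1 := by rw [hζe, Complex.norm_exp_ofReal_mul_I]
    have hre : ζ.re = Real.cos (2 * α) := by rw [hζe, Complex.exp_ofReal_mul_I_re]
    have him : ζ.im = Real.sin (2 * α) := by rw [hζe, Complex.exp_ofReal_mul_I_im]
    have hs : 0 < ζ.im := him ▸ Real.sin_pos_of_pos_of_lt_pi (by linarith) (by linarith)
    have hc : 0 ≤ ζ.re := hre ▸ Real.cos_nonneg_of_mem_Icc ⟨by linarith, by linarith⟩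
    set Z := Polynomial.nthRootsFinset n (1 : ℂ)
    have hZmem : ∀ z, z ∈ Z ↔ z ^ n = 1 := fun z => Polynomial.mem_nthRootsFinset (by omega) 1
    have hcard : Z.card = n := hprim.card_nthRootsFinset
    have hZ : ∀ z ∈ Z, ‖z‖ = 1 := fun z hz =>
      Complex.norm_eq_one_of_pow_eq_one ((hZmem z).1 hz) hn0
    have hZI : ∀ z : ℂ, z ^ 4 = 1 → z ∈ Z := fun z hz => by
      rw [hZmem, hn, pow_mul, hz, one_pow]
    have hpos : ∀ u : ℂ, ‖u‖ = 1 → ∀ v : ℂ, v ≠ 0 → ∃ z ∈ Z, 0 < ⟪z * u, v⟫ := by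
      intro u hu v hv
      by_contra! H
      have h1 := H 1 (hZI 1 (by simp))
      have h2 := H (-1) (hZI (-1) (by norm_num))
      have h3 := H Complex.I (hZI _ Complex.I_pow_four)
      have h4 := H (-Complex.I) (hZI _ (by rw [neg_pow, Complex.I_pow_four]; norm_num))
      rw [neg_mul, inner_neg_left] at h2 h4
      rw [one_mul] at h1 h2
      have h5 : ⟪u, v⟫ = 0 := by linarith
      have h6 : ⟪Complex.I * u, v⟫ = 0 := by linarith
      apply hv
      rw [complex_eq_frame hu v, h5, h6]
      simp
    have hbound := fun u hu => hausdorffMeasure_frontier_le_sum hK hconv hne hζn hs hc (u := u) hu hZ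
      (fun z hz => by rw [hZmem, mul_pow, hprim.pow_eq_one, (hZmem z).1 hz, one_mul])
      (fun z hz => by rw [hZmem, mul_pow, inv_pow, hprim.pow_eq_one, (hZmem z).1 hz]; simp)
      (hpos u hu)
    have hfin : m ≠ ⊤ := ne_top_of_le_ne_top ENNReal.ofReal_ne_top (hbound 1 (by simp))
    refine ⟨hfin, ?_⟩
    set R : ℂ → ℝ := fun u => ∑ z ∈ Z, (supportFun K (ζ * (z * u)) +
      supportFun K (ζ⁻¹ * (z * u)) - 2 * ζ.re * supportFun K (z * u)) / ζ.im with hR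
    have hRsmul : ∀ r : ℝ, 0 ≤ r → ∀ u, R (r • u) = r * R u := fun r hr u => by
      simp only [hR, Finset.mul_sum, mul_smul_comm, supportFun_smul K hr]
      exact Finset.sum_congr rfl fun z _ => by ring
    have hR1 : ∀ u : ℂ, ‖u‖ = 1 → m.toReal ≤ R u := fun u hu =>
      ENNReal.toReal_le_of_le_ofReal (Finset.sum_nonneg fun z _ => div_nonneg
        (sub_nonneg.2 (two_re_mul_supportFun_le hK hne hζn hc _)) hs.le) (hbound u hu)
    have hRx : ∀ x : ℂ, m.toReal * ‖x‖ ≤ R x := fun x => by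
      rcases eq_or_ne x 0 with rfl | hx
      · have := hRsmul 0 le_rfl 0
        simp only [zero_smul, zero_mul] at this
        simp [this]
      · have hx0 : 0 < ‖x‖ := norm_pos_iff.2 hx
        have h1 := hR1 (‖x‖⁻¹ • x) (by simp [hx])
        rw [hRsmul _ (by positivity), inv_mul_eq_div, le_div_iff₀ hx0] at h1
        exact h1
    have hint : ∀ a : ℂ, Integrable fun x : ℂ => supportFun K (a * x) * gaussWeight x := fun a => by
      obtain ⟨r, hr⟩ := hK.exists_abs_supportFun_le hne
      refine integrable_mul_gaussWeight_of_le (A := 0) (B := r * ‖a‖)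
        ((hK.continuous_supportFun hne).comp (by fun_prop)) fun x => ?_
      simpa [mul_assoc] using hr (a * x)
    have hterm : ∀ z ∈ Z, Integrable (fun x : ℂ => (supportFun K (ζ * (z * x)) +
          supportFun K (ζ⁻¹ * (z * x)) - 2 * ζ.re * supportFun K (z * x)) / ζ.im * gaussWeight x) ∧
        ∫ x : ℂ, (supportFun K (ζ * (z * x)) + supportFun K (ζ⁻¹ * (z * x)) -
          2 * ζ.re * supportFun K (z * x)) / ζ.im * gaussWeight x =
        (2 - 2 * ζ.re) / ζ.im * J := fun z hz => by
      have hfun : (fun x : ℂ => (supportFun K (ζ * (z * x)) + supportFun K (ζ⁻¹ * (z * x)) -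
          2 * ζ.re * supportFun K (z * x)) / ζ.im * gaussWeight x) = fun x =>
          ζ.im⁻¹ * ((supportFun K ((ζ * z) * x) * gaussWeight x +
            supportFun K ((ζ⁻¹ * z) * x) * gaussWeight x) -
            (2 * ζ.re) * (supportFun K (z * x) * gaussWeight x)) := by
        funext x
        simp only [mul_assoc]
        ring
      have i1 : Integrable fun x : ℂ => supportFun K ((ζ * z) * x) * gaussWeight x +
          supportFun K ((ζ⁻¹ * z) * x) * gaussWeight x := (hint (ζ * z)).add (hint (ζ⁻¹ * z))
      have i2 := (hint z).const_mul (2 * ζ.re)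
      constructor
      · rw [hfun]
        exact (i1.sub i2).const_mul _
      · rw [hfun, integral_const_mul, integral_sub i1 i2, integral_add (hint _) (hint _),
          integral_const_mul, integral_comp_mul_mul_gaussWeight _ (by simp [hζn, hZ z hz]),
          integral_comp_mul_mul_gaussWeight _ (by simp [hζn, hZ z hz]),
          integral_comp_mul_mul_gaussWeight _ (hZ z hz)]
        ring
    have hI : m.toReal * (∫ x : ℂ, ‖x‖ * gaussWeight x) ≤ n * ((2 - 2 * ζ.re) / ζ.im * J) := by
      have hsumI : ∫ x : ℂ, R x * gaussWeight x = n * ((2 - 2 * ζ.re) / ζ.im * J) := by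
        simp only [hR, Finset.sum_mul]
        rw [integral_finsetSum _ fun z hz => (hterm z hz).1,
          Finset.sum_congr rfl fun z hz => (hterm z hz).2, Finset.sum_const, hcard, nsmul_eq_mul]
      rw [← hsumI, ← integral_const_mul]
      refine integral_mono (integrable_norm_mul_gaussWeight.const_mul _) ?_ fun x => ?_
      · simp only [hR, Finset.sum_mul]
        exact integrable_finsetSum _ fun z hz => (hterm z hz).1
      · simp only [← mul_assoc]
        exact mul_le_mul_of_nonneg_right (hRx x) (gaussWeight_pos x).le
    have hcα : 0 < Real.cos α := Real.cos_pos_of_mem_Ioo ⟨by linarith, by linarith⟩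
    have hsα : 0 < Real.sin α := Real.sin_pos_of_pos_of_lt_pi hα0 (by linarith)
    have htan : (2 - 2 * ζ.re) / ζ.im * Real.cos α = 2 * Real.sin α := by
      rw [hre, him, Real.cos_two_mul, Real.sin_two_mul]
      have := Real.sin_sq_add_cos_sq α
      field_simp
      linear_combination (-2) * this
    have hN : 0 ≤ m.toReal * (∫ x : ℂ, ‖x‖ * gaussWeight x) :=
      mul_nonneg ENNReal.toReal_nonneg (integral_nonneg fun x =>
        mul_nonneg (norm_nonneg x) (gaussWeight_pos x).le)
    have hI' := mul_le_mul_of_nonneg_right hI hcα.le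
    have e : n * ((2 - 2 * ζ.re) / ζ.im * J) * Real.cos α = n * (2 * Real.sin α) * J := by
      rw [← htan]; ring
    rw [e] at hI'
    have hJ0 : 0 ≤ J := by
      have h0 : 0 ≤ n * (2 * Real.sin α) * J := (mul_nonneg hN hcα.le).trans hI'
      exact nonneg_of_mul_nonneg_right h0 (by positivity)
    rw [← hnr]
    refine hI'.trans (mul_le_mul_of_nonneg_right ?_ hJ0)
    have h1 : Real.sin α ≤ α := Real.sin_le hα0.le
    have h2 : (n : ℝ) * α = Real.pi := by rw [hα]; field_simp
    nlinarith
  refine ⟨(key 0).1, ?_⟩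
  have hlim : Filter.Tendsto (fun k : ℕ => m.toReal * (∫ x : ℂ, ‖x‖ * gaussWeight x) *
      Real.cos (Real.pi / (4 * (k + 2)))) Filter.atTop
      (nhds (m.toReal * (∫ x : ℂ, ‖x‖ * gaussWeight x) * Real.cos 0)) := by
    refine Filter.Tendsto.const_mul _ ((Real.continuous_cos.tendsto 0).comp ?_)
    refine Filter.Tendsto.const_div_atTop ?_ _
    exact Filter.Tendsto.const_mul_atTop (by norm_num)
      (Filter.tendsto_atTop_add_const_right _ _ tendsto_natCast_atTop_atTop)
  rw [Real.cos_zero, mul_one] at hlim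
  exact le_of_tendsto' hlim fun k => (key k).2

end Upper

section Inscribed

lemma dist_le_hausdorffMeasure_image_Ico {X : Type*} [MetricSpace X] [MeasurableSpace X]
    [BorelSpace X] {γ : ℝ → X} (hγ : Continuous γ) {a b : ℝ} (hab : a ≤ b) :
    ENNReal.ofReal (dist (γ a) (γ b)) ≤ μH[1] (γ '' Ico a b) := by
  have hlip : LipschitzWith 1 (dist (γ a)) := LipschitzWith.dist_right _
  have hsub := intermediate_value_Ico hab
    (f := fun t => dist (γ a) (γ t)) (by fun_prop : Continuous _).continuousOn
  calc ENNReal.ofReal (dist (γ a) (γ b))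
      = μH[1] (Ico (dist (γ a) (γ a)) (dist (γ a) (γ b))) := by
        rw [hausdorffMeasure_real, Real.volume_Ico, dist_self, sub_zero]
    _ ≤ μH[1] (dist (γ a) '' (γ '' Ico a b)) := by
        rw [image_image]; exact measure_mono hsub
    _ ≤ μH[1] (γ '' Ico a b) := by
        simpa using hlip.hausdorffMeasure_image_le zero_le_one (γ '' Ico a b)

/-- A polygon inscribed in an injective curve is not longer than the curve. -/
lemma sum_dist_le_hausdorffMeasure {X : Type*} [MetricSpace X] [MeasurableSpace X]
    [BorelSpace X] {γ : ℝ → X} (hγ : Continuous γ) {t : ℕ → ℝ} (ht : Monotone t) (n : ℕ)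
    (hinj : InjOn γ (Ico (t 0) (t n))) :
    ∑ k ∈ Finset.range n, ENNReal.ofReal (dist (γ (t k)) (γ (t (k + 1)))) ≤
      μH[1] (γ '' Ico (t 0) (t n)) := by
  induction n with
  | zero => simp
  | succ n ih =>
    have h0 : t 0 ≤ t n := ht n.zero_le
    have h1 : t n ≤ t (n + 1) := ht n.le_succ
    have hl : Ico (t 0) (t n) ⊆ Ico (t 0) (t (n + 1)) := Ico_subset_Ico_right h1
    have hr : Ico (t n) (t (n + 1)) ⊆ Ico (t 0) (t (n + 1)) := Ico_subset_Ico_left h0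
    have hdisj : Disjoint (γ '' Ico (t 0) (t n)) (γ '' Ico (t n) (t (n + 1))) :=
      disjoint_image_image fun x hx y hy hxy =>
        Ico_disjoint_Ico_same.ne_of_mem hx hy (hinj (hl hx) (hr hy) hxy)
    rw [Finset.sum_range_succ, ← Ico_union_Ico_eq_Ico h0 h1, image_union,
      measure_union hdisj (measurableSet_Ico.image_of_continuousOn_injOn hγ.continuousOn
        (hinj.mono hr))]
    exact add_le_add (ih (hinj.mono hl)) (dist_le_hausdorffMeasure_image_Ico hγ h1)

lemma two_mul_dist_le_sum_dist {X : Type*} [PseudoMetricSpace X] {a : ℕ → X} {n : ℕ}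
    (ha : a n = a 0) {i j : ℕ} (hi : i ≤ n) (hj : j ≤ n) :
    2 * dist (a i) (a j) ≤ ∑ k ∈ Finset.range n, dist (a k) (a (k + 1)) := by
  wlog hij : i ≤ j generalizing i j
  · rw [dist_comm]; exact this hj hi (by omega)
  have h1 := dist_le_Ico_sum_dist a (Nat.zero_le i)
  have h2 := dist_le_Ico_sum_dist a hij
  have h3 := dist_le_Ico_sum_dist a hj
  rw [Finset.range_eq_Ico, ← Finset.sum_Ico_consecutive _ (Nat.zero_le j) hj,
    ← Finset.sum_Ico_consecutive _ (Nat.zero_le i) hij]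
  have h4 := dist_triangle_left (a i) (a j) (a 0)
  rw [ha, dist_comm (a j)] at h3
  linarith

lemma integral_abs_inner_mul_gaussWeight (e : ℂ) :
    ∫ x : ℂ, |⟪x, e⟫| * gaussWeight x = ‖e‖ * ∫ x : ℂ, |x.re| * gaussWeight x := by
  rcases eq_or_ne e 0 with rfl | he
  · simp
  have he0 : (‖e‖ : ℂ) ≠ 0 := by simpa using he
  have hz : ‖(starRingEnd ℂ) e / ‖e‖‖ = 1 := by simp [he]
  rw [← integral_comp_mul_mul_gaussWeight (fun x => |x.re|) hz, ← integral_const_mul]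
  refine integral_congr_ae (.of_forall fun x => ?_)
  have h : ⟪x, e⟫ = ‖e‖ * ((starRingEnd ℂ) e / ‖e‖ * x).re := by
    rw [← Complex.re_ofReal_mul, ← mul_assoc, mul_div_cancel₀ _ he0, real_inner_comm,
      Complex.inner]
    simp [mul_comm]
  simp only [h, abs_mul, abs_norm, mul_assoc]

lemma integrable_abs_inner_mul_gaussWeight (e : ℂ) :
    Integrable fun x : ℂ => |⟪x, e⟫| * gaussWeight x :=
  integrable_mul_gaussWeight_of_le (A := 0) (B := ‖e‖) (by fun_prop) fun x => by
    rw [abs_abs, zero_add, mul_comm]; exact abs_real_inner_le_norm x e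

/-- Cauchy's formula, lower bound for the length of a closed polygon. -/
lemma four_mul_integral_supportFun_le {a : ℕ → ℂ} {n : ℕ} (hn : 0 < n) (ha : a n = a 0) :
    4 * ∫ x, supportFun (a '' Iio n) x * gaussWeight x ≤
      (∫ x : ℂ, |x.re| * gaussWeight x) * ∑ k ∈ Finset.range n, dist (a k) (a (k + 1)) := by
  set A := a '' Iio n with hA
  have hAc : IsCompact A := ((finite_Iio n).image a).isCompact
  have hAne : A.Nonempty := ⟨a 0, 0, hn, rfl⟩
  have hle : ∀ x, 2 * (supportFun A x + supportFun A (-1 * x)) ≤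
      ∑ k ∈ Finset.range n, |⟪x, a k - a (k + 1)⟫| := fun x => by
    obtain ⟨_, ⟨i, hi, rfl⟩, hpi⟩ := hAc.exists_inner_eq_supportFun hAne x
    obtain ⟨_, ⟨j, hj, rfl⟩, hpj⟩ := hAc.exists_inner_eq_supportFun hAne (-1 * x)
    have h := two_mul_dist_le_sum_dist (a := fun k => ⟪x, a k⟫) (n := n) (by simp only [ha])
      (le_of_lt hi) (le_of_lt hj)
    simp only [Real.dist_eq, ← inner_sub_right] at h
    refine le_trans ?_ h
    rw [← hpi, ← hpj, neg_one_mul, inner_neg_left, ← sub_eq_add_neg, ← inner_sub_right]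
    linarith [le_abs_self ⟪x, a i - a j⟫]
  have hI := hAc.integrable_supportFun_mul_gaussWeight hAne
  have hI' : Integrable fun x : ℂ => supportFun A (-1 * x) * gaussWeight x := by
    obtain ⟨r, hr⟩ := hAc.exists_abs_supportFun_le hAne
    refine integrable_mul_gaussWeight_of_le (A := 0) (B := r)
      ((hAc.continuous_supportFun hAne).comp (by fun_prop)) fun x => ?_
    simpa using hr (-1 * x)
  calc 4 * ∫ x, supportFun A x * gaussWeight x
      = ∫ x, 2 * (supportFun A x * gaussWeight x + supportFun A (-1 * x) * gaussWeight x) := by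
        rw [integral_const_mul, integral_add hI hI',
          integral_comp_mul_mul_gaussWeight _ (by simp)]
        ring
    _ ≤ ∫ x, ∑ k ∈ Finset.range n, |⟪x, a k - a (k + 1)⟫| * gaussWeight x := by
        refine integral_mono ((hI.add hI').const_mul 2)
          (integrable_finsetSum _ fun k _ => integrable_abs_inner_mul_gaussWeight _) fun x => ?_
        simp only [← Finset.sum_mul, ← add_mul, ← mul_assoc]
        exact mul_le_mul_of_nonneg_right (hle x) (gaussWeight_pos x).le
    _ = _ := by
        rw [integral_finsetSum _ fun k _ => integrable_abs_inner_mul_gaussWeight _, Finset.mul_sum]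
        refine Finset.sum_congr rfl fun k _ => ?_
        rw [integral_abs_inner_mul_gaussWeight, dist_eq_norm, mul_comm]

lemma supportFun_le_supportFun_frontier {V : Type*} [NormedAddCommGroup V] [InnerProductSpace ℝ V]
    {M : Set V} (hM : IsCompact M) (hne : (frontier M).Nonempty) (x : V) :
    supportFun M x ≤ supportFun (frontier M) x := by
  have hMne : M.Nonempty := hne.mono hM.isClosed.frontier_subset
  have hF : IsCompact (frontier M) := hM.of_isClosed_subset isClosed_frontier
    hM.isClosed.frontier_subset
  obtain ⟨p, hp, hpx⟩ := hM.exists_inner_eq_supportFun hMne x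
  rw [← hpx]
  by_cases hpi : p ∈ interior M
  · have hev : ∀ᶠ t : ℝ in nhds 0, p + t • x ∈ M := by
      have hc : Filter.Tendsto (fun t : ℝ => p + t • x) (nhds 0) (nhds p) := by
        have : Continuous fun t : ℝ => p + t • x := by fun_prop
        simpa using this.tendsto 0
      exact hc.eventually (mem_interior_iff_mem_nhds.1 hpi)
    obtain ⟨t, htM, ht⟩ := ((hev.filter_mono nhdsWithin_le_nhds).and
      (self_mem_nhdsWithin (s := Ioi (0 : ℝ)))).exists
    have h := hM.inner_le_supportFun x htM
    rw [← hpx, inner_add_right, real_inner_smul_right, add_le_iff_nonpos_right] at h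
    have hx : x = 0 := real_inner_self_nonpos.1 (nonpos_of_mul_nonpos_right h ht)
    obtain ⟨q, hq⟩ := hne
    simpa [hx] using hF.inner_le_supportFun x hq
  · exact hF.inner_le_supportFun x ⟨subset_closure hp, hpi⟩

/-- The radial parametrization of the boundary of a convex body. -/
lemma exists_radial_parametrization {M : Set ℂ} (hM : IsCompact M) (hconv : Convex ℝ M)
    (h0 : M ∈ nhds 0) : ∃ γ : ℝ → ℂ, Continuous γ ∧ InjOn γ (Ico 0 (2 * Real.pi)) ∧
      γ '' Ico 0 (2 * Real.pi) = frontier M ∧ γ (2 * Real.pi) = γ 0 := by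
  have hpi := Real.two_pi_pos
  set u : ℝ → ℂ := fun θ => Complex.exp (θ * Complex.I) with hu
  have hu1 : ∀ θ, ‖u θ‖ = 1 := Complex.norm_exp_ofReal_mul_I
  have huc : Continuous u := by fun_prop
  have hgpos : ∀ z : ℂ, z ≠ 0 → 0 < gauge M z := fun z hz =>
    (gauge_pos (absorbent_nhds_zero h0)
      ((NormedSpace.isVonNBounded_iff ℝ).2 hM.isBounded)).2 hz
  have hg : ∀ θ, 0 < gauge M (u θ) := fun θ => hgpos _ (Complex.exp_ne_zero _)
  have hper : ∀ θ : ℝ, u (θ + 2 * Real.pi) = u θ := fun θ => by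
    simp only [hu]; push_cast; rw [add_mul, Complex.exp_periodic]
  refine ⟨fun θ => (gauge M (u θ))⁻¹ • u θ,
    (((continuous_gauge hconv h0).comp huc).inv₀ fun θ => (hg θ).ne').smul huc, ?_, ?_, ?_⟩
  · intro θ hθ φ hφ h
    have hn : (gauge M (u θ))⁻¹ = (gauge M (u φ))⁻¹ := by
      have := congrArg norm h
      simpa [norm_smul, hu1, abs_of_pos (hg _)] using this
    have hne : (gauge M (u φ))⁻¹ ≠ 0 := inv_ne_zero (hg φ).ne'
    have he : u θ = u φ := by
      simp only [hn] at h
      exact smul_right_injective ℂ hne h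
    obtain ⟨k, hk⟩ := Complex.exp_eq_exp_iff_exists_int.1 he
    have hk' : θ = φ + k * (2 * Real.pi) := by
      have := congrArg Complex.im hk
      simpa using this
    have hk1 : (k : ℝ) < 1 := by
      by_contra! hk1
      nlinarith [hθ.1, hθ.2, hφ.1, hφ.2]
    have hk2 : (-1 : ℝ) < k := by
      by_contra! hk2
      nlinarith [hθ.1, hθ.2, hφ.1, hφ.2]
    have hk0 : k = 0 := by
      have h1 : k < 1 := by exact_mod_cast hk1
      have h2 : -1 < k := by exact_mod_cast hk2
      omega
    simpa [hk0] using hk'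
  · apply Subset.antisymm
    · rintro _ ⟨θ, -, rfl⟩
      rw [← gauge_eq_one_iff_mem_frontier hconv h0, gauge_smul_of_nonneg (inv_nonneg.2 (hg θ).le),
        smul_eq_mul, inv_mul_cancel₀ (hg θ).ne']
    · intro p hp
      have hp1 := (gauge_eq_one_iff_mem_frontier hconv h0).2 hp
      have hp0 : p ≠ 0 := by rintro rfl; simp at hp1
      obtain ⟨θ, hθ, hθu⟩ : ∃ θ ∈ Ico 0 (2 * Real.pi), u θ = u p.arg := by
        rcases le_or_gt 0 p.arg with h | h
        · exact ⟨p.arg, ⟨h, by linarith [p.arg_le_pi]⟩, rfl⟩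
        · exact ⟨p.arg + 2 * Real.pi, ⟨by linarith [p.neg_pi_lt_arg], by linarith⟩, hper _⟩
      refine ⟨θ, hθ, ?_⟩
      have hpu : p = ‖p‖ • u p.arg := by
        rw [Complex.real_smul]; exact (Complex.norm_mul_exp_arg_mul_I p).symm
      have hgu : ‖p‖ * gauge M (u p.arg) = 1 := by
        rw [← hp1]
        conv_rhs => rw [hpu, gauge_smul_of_nonneg (norm_nonneg p), smul_eq_mul]
      simp only [hθu]
      rw [← eq_inv_of_mul_eq_one_left hgu]
      exact hpu.symm
  · have := hper 0
    rw [zero_add] at this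
    simp only [this]

/-- Cauchy's formula, lower bound for the perimeter. -/
lemma four_mul_integral_supportFun_le_hausdorffMeasure_frontier {M : Set ℂ} (hM : IsCompact M)
    (hconv : Convex ℝ M) (h0 : M ∈ nhds 0) (hfin : μH[1] (frontier M) ≠ ⊤) :
    4 * ∫ x, supportFun M x * gaussWeight x ≤
      (∫ x : ℂ, |x.re| * gaussWeight x) * (μH[1] (frontier M)).toReal := by
  obtain ⟨γ, hγ, hinj, himg, hclosed⟩ := exists_radial_parametrization hM hconv h0
  have hpi := Real.two_pi_pos
  have hMne : M.Nonempty := ⟨0, mem_of_mem_nhds h0⟩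
  have hFne : (frontier M).Nonempty := himg ▸ (nonempty_Ico.2 hpi).image γ
  have hF : IsCompact (frontier M) := hM.of_isClosed_subset isClosed_frontier
    hM.isClosed.frontier_subset
  set N := ∫ x : ℂ, ‖x‖ * gaussWeight x with hN
  set κ := ∫ x : ℂ, |x.re| * gaussWeight x with hκ
  have hκ0 : 0 ≤ κ := integral_nonneg fun x => mul_nonneg (abs_nonneg _) (gaussWeight_pos x).le
  have hN0 : 0 ≤ N := integral_nonneg fun x => mul_nonneg (norm_nonneg _) (gaussWeight_pos x).le
  have key : ∀ ε > 0, 4 * ∫ x, supportFun M x * gaussWeight x ≤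
      κ * (μH[1] (frontier M)).toReal + 4 * (ε * N) := fun ε hε => by
    have huc := (isCompact_Icc (a := (0 : ℝ)) (b := 2 * Real.pi)).uniformContinuousOn_of_continuous
      hγ.continuousOn
    obtain ⟨δ, hδ, hγδ⟩ := Metric.uniformContinuousOn_iff.1 huc ε hε
    obtain ⟨n, hn⟩ := exists_nat_gt (2 * Real.pi / δ)
    have hn0 : (0 : ℝ) < n := (by positivity : 0 < 2 * Real.pi / δ).trans hn
    have hnδ : 2 * Real.pi / n < δ := by
      rw [div_lt_iff₀ hδ] at hn
      rw [div_lt_iff₀ hn0]; linarith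
    set d := 2 * Real.pi / n with hd
    have hd0 : 0 < d := by positivity
    have hnd : n * d = 2 * Real.pi := by rw [hd]; field_simp
    set t : ℕ → ℝ := fun k => k * d with ht
    have htm : Monotone t := fun i j hij =>
      mul_le_mul_of_nonneg_right (by exact_mod_cast hij) hd0.le
    have ht0 : t 0 = 0 := by simp [ht]
    have htn : t n = 2 * Real.pi := hnd
    set a : ℕ → ℂ := fun k => γ (t k) with ha
    have hsum : ∑ k ∈ Finset.range n, dist (a k) (a (k + 1)) ≤ (μH[1] (frontier M)).toReal := by
      have h := sum_dist_le_hausdorffMeasure hγ htm n (by rwa [ht0, htn])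
      rw [ht0, htn, himg, ← ENNReal.ofReal_sum_of_nonneg fun _ _ => dist_nonneg] at h
      exact (ENNReal.ofReal_le_iff_le_toReal hfin).1 h
    have hpoly := four_mul_integral_supportFun_le (a := a) (n := n) (by exact_mod_cast hn0)
      (by simp only [ha, ht0, htn, hclosed])
    have hnet : ∀ p ∈ frontier M, ∃ q ∈ a '' Iio n, dist p q ≤ ε := by
      rw [← himg]
      rintro _ ⟨θ, hθ, rfl⟩
      have hθd : 0 ≤ θ / d := div_nonneg hθ.1 hd0.le
      have hfl := Nat.floor_le hθd
      have hlt := Nat.lt_floor_add_one (θ / d)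
      rw [le_div_iff₀ hd0] at hfl
      rw [div_lt_iff₀ hd0] at hlt
      have hkn : ⌊θ / d⌋₊ < n := by
        rw [Nat.floor_lt hθd, div_lt_iff₀ hd0, hnd]; exact hθ.2
      refine ⟨_, ⟨_, hkn, rfl⟩, (hγδ θ ⟨hθ.1, hθ.2.le⟩ _ ⟨by positivity, hfl.trans hθ.2.le⟩ ?_).le⟩
      rw [Real.dist_eq, abs_lt]
      constructor <;> linarith
    have hA : IsCompact (a '' Iio n) := ((finite_Iio n).image a).isCompact
    have hAne : (a '' Iio n).Nonempty := ⟨a 0, 0, by exact_mod_cast hn0, rfl⟩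
    have h1 := integral_supportFun_le_of_net hF hA hFne hAne hnet
    have h2 : ∫ x, supportFun M x * gaussWeight x ≤
        ∫ x, supportFun (frontier M) x * gaussWeight x :=
      integral_mono (hM.integrable_supportFun_mul_gaussWeight hMne)
        (hF.integrable_supportFun_mul_gaussWeight hFne) fun x =>
          mul_le_mul_of_nonneg_right (supportFun_le_supportFun_frontier hM hFne x)
            (gaussWeight_pos x).le
    have h3 := mul_le_mul_of_nonneg_left hsum hκ0
    linarith
  refine le_of_forall_pos_le_add fun ε hε => ?_
  have h := key (ε / (4 * (N + 1))) (by positivity)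
  refine h.trans (add_le_add_right ?_ _)
  have : 4 * (ε / (4 * (N + 1)) * N) = ε * (N / (N + 1)) := by field_simp
  rw [this]
  exact mul_le_of_le_one_right hε.le ((div_le_one (by positivity)).2 (by linarith))

end Inscribed

section Constants

lemma integral_norm_mul_gaussWeight :
    ∫ x : ℂ, ‖x‖ * gaussWeight x = Real.pi * √(2 * Real.pi) := by
  have h := Complex.integral_rpow_mul_exp_neg_mul_rpow (p := 2) (q := 1) (b := 1 / 2)
    one_le_two (by norm_num) (by norm_num)
  have hΓ : Real.Gamma ((1 + 2) / 2) = √Real.pi / 2 := by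
    rw [show ((1 : ℝ) + 2) / 2 = 1 / 2 + 1 by norm_num, Real.Gamma_add_one (by norm_num),
      Real.Gamma_one_half_eq]
    ring
  have hb : (1 / 2 : ℝ) ^ (-(1 + 2) / 2 : ℝ) = 2 * √2 := by
    rw [one_div, Real.inv_rpow zero_le_two, ← Real.rpow_neg zero_le_two,
      show (-(-(1 + 2) / 2) : ℝ) = 1 + 1 / 2 by norm_num, Real.rpow_add two_pos, Real.rpow_one,
      Real.sqrt_eq_rpow]
  rw [hΓ, hb] at h
  rw [Real.sqrt_mul zero_le_two]
  have e : ∫ x : ℂ, ‖x‖ * gaussWeight x =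
      ∫ x : ℂ, ‖x‖ ^ (1 : ℝ) * Real.exp (-(1 / 2) * ‖x‖ ^ (2 : ℝ)) := by
    refine integral_congr_ae (.of_forall fun x => ?_)
    simp only [Real.rpow_one, Real.rpow_two, gaussWeight]
    ring_nf
  rw [e, h]
  ring

lemma integral_abs_re_mul_gaussWeight :
    ∫ x : ℂ, |x.re| * gaussWeight x = 2 * √(2 * Real.pi) := by
  have h1 : ∫ t : ℝ, |t| * Real.exp (-(1 / 2) * t ^ 2) = 2 := by
    have h := integral_comp_abs (f := fun t => t * Real.exp (-(1 / 2) * t ^ 2))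
    have h2 := integral_rpow_mul_exp_neg_mul_rpow (p := 2) (q := 1) (b := 1 / 2)
      two_pos (by norm_num) (by norm_num)
    simp only [sq_abs] at h
    simp only [Real.rpow_one, Real.rpow_two] at h2
    rw [h, h2, show (-(1 + 1) / 2 : ℝ) = -1 by norm_num, Real.rpow_neg_one]
    norm_num
  have h2 : ∫ t : ℝ, Real.exp (-(1 / 2) * t ^ 2) = √(2 * Real.pi) := by
    rw [integral_gaussian]; congr 1; ring
  have h3 := congrArg₂ (· * ·) h1 h2
  rw [← h3, ← integral_prod_mul, ← Measure.volume_eq_prod,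
    ← Complex.volume_preserving_equiv_real_prod.integral_comp
      Complex.measurableEquivRealProd.measurableEmbedding]
  refine integral_congr_ae (.of_forall fun x => ?_)
  simp only [Complex.measurableEquivRealProd_apply, gaussWeight, ← Complex.normSq_eq_norm_sq,
    Complex.normSq_apply]
  rw [mul_assoc, ← Real.exp_add]
  ring_nf

end Constants

section Comparison

lemma hausdorffMeasure_frontier_image_le {M : Set ℂ} (hM : IsCompact M) (hconv : Convex ℝ M)
    (h0 : M ∈ nhds 0) {f : ℂ → ℂ} (hf : LipschitzOnWith 1 f M) (hconv' : Convex ℝ (f '' M)) :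
    μH[1] (frontier (f '' M)) ≤ μH[1] (frontier M) := by
  by_cases hfin : μH[1] (frontier M) = ⊤
  · rw [hfin]; exact le_top
  have hne : M.Nonempty := ⟨0, mem_of_mem_nhds h0⟩
  obtain ⟨hfin', hupper⟩ := hausdorffMeasure_frontier_le (hM.image_of_continuousOn hf.continuousOn)
    hconv' (hne.image f)
  have hlower := four_mul_integral_supportFun_le_hausdorffMeasure_frontier hM hconv h0 hfin
  have hmid := integral_supportFun_image_le hM hne hf
  rw [integral_norm_mul_gaussWeight] at hupper
  rw [integral_abs_re_mul_gaussWeight] at hlower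
  rw [← ENNReal.toReal_le_toReal hfin' hfin]
  have hpi := Real.pi_pos
  have hc : 0 < Real.pi * √(2 * Real.pi) := by positivity
  refine le_of_mul_le_mul_right (hupper.trans ?_) hc
  have h1 := mul_le_mul_of_nonneg_left hmid hpi.le
  have h2 := mul_le_mul_of_nonneg_left hlower hpi.le
  linarith

end Comparison

end PerimeterComparison

/-- If a compact convex set `M` in the plane (with nonempty interior) is mapped by a
1-Lipschitz map `f` onto a convex set `f '' M`, then the perimeter (1-dimensional
Hausdorff measure of the boundary) of `f '' M` is at most that of `M`. -/
theorem flat_fold_convex_perimeter_le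
    (M : Set (EuclideanSpace ℝ (Fin 2)))
    (f : EuclideanSpace ℝ (Fin 2) → EuclideanSpace ℝ (Fin 2))
    (hMc : IsCompact M) (hMconv : Convex ℝ M) (hMint : (interior M).Nonempty)
    (hf : LipschitzOnWith 1 f M) (hM' : Convex ℝ (f '' M)) :
    μH[1] (frontier (f '' M)) ≤ μH[1] (frontier M) := by
  obtain ⟨o, ho⟩ := hMint
  let L := Complex.orthonormalBasisOneI.repr.symm
  let e : EuclideanSpace ℝ (Fin 2) ≃ᵃⁱ[ℝ] ℂ :=
    L.toAffineIsometryEquiv.trans (AffineIsometryEquiv.constVAdd ℝ ℂ (-L o))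
  have heo : e o = 0 := neg_add_cancel (L o)
  have hfront : ∀ S : Set (EuclideanSpace ℝ (Fin 2)),
      μH[1] (frontier (e '' S)) = μH[1] (frontier S) := fun S => by
    have h := e.toHomeomorph.image_frontier S
    rw [AffineIsometryEquiv.coe_toHomeomorph] at h
    rw [← h]
    exact e.toIsometryEquiv.hausdorffMeasure_image 1 _
  have hconv : ∀ S : Set (EuclideanSpace ℝ (Fin 2)), Convex ℝ S → Convex ℝ (e '' S) :=
    fun S hS => hS.affine_image e.toAffineEquiv.toAffineMap
  have himg : (e ∘ f ∘ e.symm) '' (e '' M) = e '' (f '' M) := by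
    simp [image_image]
  have hlip : LipschitzOnWith 1 (e ∘ f ∘ e.symm) (e '' M) := by
    refine LipschitzOnWith.of_dist_le_mul ?_
    rintro _ ⟨x, hx, rfl⟩ _ ⟨y, hy, rfl⟩
    simpa using hf.dist_le_mul x hx y hy
  have h0 : e '' M ∈ nhds 0 := heo ▸
    e.toHomeomorph.isOpenMap.image_mem_nhds (mem_interior_iff_mem_nhds.1 ho)
  have h := hausdorffMeasure_frontier_image_le (hMc.image e.continuous) (hconv M hMconv) h0 hlip
    (himg ▸ hconv _ hM')
  rwa [himg, hfront, hfront] at h
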